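/- arXiv:2604.06478 — 2 statements merged into one kernel-verified Lean document; each statement's English description precedes it below -/
import Mathlib

section
/- Let μ ≥ 0, d > μ, η > 0, c > 0, T > 0, and define γ(t) := 2η + (μ−d)/(1+t). Let F : [0,T) → ℝ be differentiable with F(0) > 0 and suppose F'(t) + γ(t)·F(t) ≥ c for all t ∈ [0,T). Then F(t) ≥ (c/(2η))·(1 − e^{−ηt}) for all t ∈ [0,T). Moreover, if in addition η ≥ 2, then F(t) ≥ c/(4η) for all t ∈ [1,T). -/
/-- A differential inequality `0 ≤ G' + A' * G` propagates nonnegativity of `G` from `0`. -/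
theorem nonneg_of_deriv_add_mul_nonneg {T : ℝ} {A A' G G' : ℝ → ℝ}
    (hA : ∀ t ∈ Set.Ico (0 : ℝ) T, HasDerivAt A (A' t) t)
    (hG : ∀ t ∈ Set.Ico (0 : ℝ) T, HasDerivAt G (G' t) t)
    (hG0 : 0 ≤ G 0) (h : ∀ t ∈ Set.Ico (0 : ℝ) T, 0 ≤ G' t + A' t * G t) :
    ∀ t ∈ Set.Ico (0 : ℝ) T, 0 ≤ G t := by
  intro t ht
  have hderiv : ∀ s ∈ Set.Ico (0 : ℝ) T,
      HasDerivAt (fun s => Real.exp (A s) * G s) (Real.exp (A s) * (G' s + A' s * G s)) s := by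
    intro s hs
    exact ((hA s hs).exp.mul (hG s hs)).congr_deriv (by ring)
  have hmono : MonotoneOn (fun s => Real.exp (A s) * G s) (Set.Ico 0 T) := by
    refine monotoneOn_of_deriv_nonneg (convex_Ico 0 T)
      (fun s hs => (hderiv s hs).continuousAt.continuousWithinAt)
      (fun s hs => (hderiv s (interior_subset hs)).differentiableAt.differentiableWithinAt) ?_
    intro s hs
    have hs' := interior_subset hs
    rw [(hderiv s hs').deriv]
    exact mul_nonneg (Real.exp_pos _).le (h s hs')
  have hle := hmono ⟨le_rfl, ht.1.trans_lt ht.2⟩ ht ht.1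
  exact nonneg_of_mul_nonneg_right ((mul_nonneg (Real.exp_pos _).le hG0).trans hle) (Real.exp_pos _)


/-- Integrating-factor lower bound (Lemma 3.2): if F' + γ·F ≥ c on [0,T) with
γ(t) = 2η + (μ−d)/(1+t), F(0) > 0, then F(t) ≥ (c/(2η))(1 − e^{−ηt}) on [0,T);
and if moreover η ≥ 2, then F(t) ≥ c/(4η) on [1,T). -/
theorem integrating_factor_lower_bound (μ d η c T : ℝ)
    (hμ : 0 ≤ μ) (hd : μ < d) (hη : 0 < η) (hc : 0 < c) (hT : 0 < T)
    (γ : ℝ → ℝ) (hγ : ∀ t : ℝ, γ t = 2 * η + (μ - d) / (1 + t))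
    (F F' : ℝ → ℝ)
    (hF : ∀ t ∈ Set.Ico (0 : ℝ) T, HasDerivAt F (F' t) t)
    (hF0 : 0 < F 0)
    (hineq : ∀ t ∈ Set.Ico (0 : ℝ) T, F' t + γ t * F t ≥ c) :
    (∀ t ∈ Set.Ico (0 : ℝ) T, F t ≥ (c / (2 * η)) * (1 - Real.exp (-η * t))) ∧
      (η ≥ 2 → ∀ t ∈ Set.Ico (1 : ℝ) T, F t ≥ c / (4 * η)) := by
  have hnonneg : ∀ t ∈ Set.Ico (0 : ℝ) T, 0 ≤ F t := by
    refine nonneg_of_deriv_add_mul_nonneg (A := fun t => 2 * η * t + (μ - d) * Real.log (1 + t))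
      (A' := γ) ?_ hF hF0.le fun t ht => hc.le.trans (hineq t ht)
    intro t ht
    have hpos : (1 + t) ≠ 0 := by linarith [ht.1]
    have hlin := (hasDerivAt_id t).const_mul (2 * η)
    have hlog := (((hasDerivAt_id t).const_add 1).log hpos).const_mul (μ - d)
    refine (hlin.add hlog).congr_deriv ?_
    rw [hγ]
    simp [div_eq_mul_inv]
  have hmain : ∀ t ∈ Set.Ico (0 : ℝ) T,
      F t ≥ (c / (2 * η)) * (1 - Real.exp (-η * t)) := by
    have hsub : ∀ t ∈ Set.Ico (0 : ℝ) T,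
        0 ≤ F t - c / (2 * η) * (1 - Real.exp (-(2 * η) * t)) := by
      refine nonneg_of_deriv_add_mul_nonneg (A := fun t => 2 * η * t) (A' := fun _ => 2 * η)
        (G := fun t => F t - c / (2 * η) * (1 - Real.exp (-(2 * η) * t)))
        (G' := fun t => F' t - c * Real.exp (-(2 * η) * t)) ?_ ?_ (by simpa using hF0.le) ?_
      · intro t _
        simpa using (hasDerivAt_id t).const_mul (2 * η)
      · intro t ht
        have hexp := ((((hasDerivAt_id t).const_mul (-(2 * η))).exp).const_sub 1).const_mul
          (c / (2 * η))
        refine ((hF t ht).sub hexp).congr_deriv ?_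
        simp only [id]
        field_simp
      · intro t ht
        have hγle : γ t * F t ≤ 2 * η * F t := by
          refine mul_le_mul_of_nonneg_right ?_ (hnonneg t ht)
          rw [hγ]
          linarith [div_nonpos_of_nonpos_of_nonneg (sub_nonpos.2 hd.le)
            (show (0 : ℝ) ≤ 1 + t by linarith [ht.1])]
        have hcancel : 2 * η * (c / (2 * η) * (1 - Real.exp (-(2 * η) * t))) =
            c * (1 - Real.exp (-(2 * η) * t)) := by
          field_simp
        rw [mul_sub, hcancel]
        linarith [hineq t ht]
    intro t ht
    have hexp : Real.exp (-(2 * η) * t) ≤ Real.exp (-η * t) :=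
      Real.exp_le_exp.2 (by nlinarith [mul_nonneg hη.le ht.1])
    have hle : c / (2 * η) * (1 - Real.exp (-η * t)) ≤
        c / (2 * η) * (1 - Real.exp (-(2 * η) * t)) := by
      gcongr
    linarith [hsub t ht]
  refine ⟨hmain, fun hη2 t ht => ?_⟩
  have hexp : Real.exp (-η * t) ≤ 1 / 2 := by
    rw [neg_mul, Real.exp_neg, one_div]
    refine inv_anti₀ two_pos ?_
    nlinarith [Real.add_one_le_exp (η * t), ht.1]
  calc F t ≥ c / (2 * η) * (1 - Real.exp (-η * t)) := hmain t ⟨by linarith [ht.1], ht.2⟩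
    _ ≥ c / (2 * η) * (1 / 2) := by
      gcongr
      linarith
    _ = c / (4 * η) := by ring
end

section
/- Let μ ≥ 0, d > μ, η > 0, c > 0, T > 0, and define γ(t) := 2η + (μ−d)/(1+t). Let V : [0,T) → ℝ be differentiable with V(0) ≥ 0 and suppose V'(t) + (3/4)·γ(t)·V(t) ≥ (η·c)/4 for all t ∈ [0,T). Then V(t) ≥ (c/6)·(1 − e^{−3ηt/4}) for all t ∈ [0,T); in particular V(t) ≥ 0 on [0,T). Moreover, if in addition η ≥ 2, then V(t) ≥ c/18 for all t ∈ [1,T). -/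
/-- If `W' + A' W ≥ 0` on `[0, T)`, then `exp A * W` is nondecreasing there. -/
theorem monotoneOn_exp_mul_of_deriv_add_mul_nonneg {T : ℝ} {A A' W W' : ℝ → ℝ}
    (hA : ∀ t ∈ Set.Ico (0 : ℝ) T, HasDerivAt A (A' t) t)
    (hW : ∀ t ∈ Set.Ico (0 : ℝ) T, HasDerivAt W (W' t) t)
    (h : ∀ t ∈ Set.Ico (0 : ℝ) T, 0 ≤ W' t + A' t * W t) :
    MonotoneOn (fun t => Real.exp (A t) * W t) (Set.Ico 0 T) := by
  have hF : ∀ t ∈ Set.Ico (0 : ℝ) T, HasDerivAt (fun t => Real.exp (A t) * W t)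
      (Real.exp (A t) * (W' t + A' t * W t)) t := fun t ht =>
    ((hA t ht).exp.mul (hW t ht)).congr_deriv (by ring)
  refine monotoneOn_of_hasDerivWithinAt_nonneg (convex_Ico 0 T)
    (fun t ht => (hF t ht).continuousAt.continuousWithinAt)
    (fun t ht => (hF t (interior_subset ht)).hasDerivWithinAt) fun t ht => ?_
  exact mul_nonneg (Real.exp_pos _).le (h t (interior_subset ht))

/-- Integrating-factor lower bound (Lemma 3.3): if V' + (3/4)γ·V ≥ ηc/4 on [0,T)
with γ(t) = 2η + (μ−d)/(1+t) and V(0) ≥ 0, then V(t) ≥ (c/6)(1 − e^{−3ηt/4}) on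
[0,T) (in particular V ≥ 0); and if moreover η ≥ 2, then V(t) ≥ c/18 on [1,T). -/
theorem integrating_factor_lower_bound_V (μ d η c T : ℝ)
    (hμ : 0 ≤ μ) (hd : μ < d) (hη : 0 < η) (hc : 0 < c) (hT : 0 < T)
    (γ : ℝ → ℝ) (hγ : ∀ t : ℝ, γ t = 2 * η + (μ - d) / (1 + t))
    (V V' : ℝ → ℝ)
    (hV : ∀ t ∈ Set.Ico (0 : ℝ) T, HasDerivAt V (V' t) t)
    (hV0 : 0 ≤ V 0)
    (hineq : ∀ t ∈ Set.Ico (0 : ℝ) T, V' t + (3 / 4) * γ t * V t ≥ η * c / 4) :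
    (∀ t ∈ Set.Ico (0 : ℝ) T, V t ≥ (c / 6) * (1 - Real.exp (-(3 * η * t / 4)))) ∧
      (∀ t ∈ Set.Ico (0 : ℝ) T, 0 ≤ V t) ∧
      (η ≥ 2 → ∀ t ∈ Set.Ico (1 : ℝ) T, V t ≥ c / 18) := by
  have h0 : (0 : ℝ) ∈ Set.Ico (0 : ℝ) T := ⟨le_rfl, hT⟩
  have hnonneg : ∀ t ∈ Set.Ico (0 : ℝ) T, 0 ≤ V t := by
    intro t ht
    have hA : ∀ s ∈ Set.Ico (0 : ℝ) T, HasDerivAt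
        (fun s => 3 / 4 * (2 * η * s + (μ - d) * Real.log (1 + s))) (3 / 4 * γ s) s := by
      intro s hs
      have hs1 : 1 + s ≠ 0 := by linarith [hs.1]
      have hlog := (((hasDerivAt_id s).const_add 1).log hs1).const_mul (μ - d)
      refine ((((hasDerivAt_id s).const_mul (2 * η)).add hlog).const_mul (3 / 4)).congr_deriv ?_
      rw [hγ]
      simp only [id]
      ring
    have hmono := monotoneOn_exp_mul_of_deriv_add_mul_nonneg hA hV fun s hs =>
      (by positivity : (0 : ℝ) ≤ η * c / 4).trans (hineq s hs)
    have hle := hmono h0 ht ht.1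
    exact nonneg_of_mul_nonneg_right ((mul_nonneg (Real.exp_pos _).le hV0).trans hle)
      (Real.exp_pos _)
  have hlower : ∀ t ∈ Set.Ico (0 : ℝ) T,
      V t ≥ (c / 6) * (1 - Real.exp (-(3 * η * t / 4))) := by
    intro t ht
    have hA : ∀ s ∈ Set.Ico (0 : ℝ) T,
        HasDerivAt (fun s => 3 / 2 * η * s) (3 / 2 * η) s := fun s _ =>
      ((hasDerivAt_id s).const_mul (3 / 2 * η)).congr_deriv (mul_one _)
    have hmono := monotoneOn_exp_mul_of_deriv_add_mul_nonneg hA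
      (fun s hs => (hV s hs).sub_const (c / 6)) fun s hs => by
        have hγs : γ s ≤ 2 * η := by
          rw [hγ]
          linarith [div_nonpos_of_nonpos_of_nonneg (sub_nonpos.2 hd.le)
            (by linarith [hs.1] : (0 : ℝ) ≤ 1 + s)]
        have hγV := mul_le_mul_of_nonneg_right hγs (hnonneg s hs)
        linarith [hineq s hs]
    have hle := hmono h0 ht ht.1
    simp only [mul_zero, Real.exp_zero, one_mul] at hle
    have hmul : Real.exp (-(3 / 2 * η * t)) * Real.exp (3 / 2 * η * t) = 1 := by
      rw [← Real.exp_add, neg_add_cancel, Real.exp_zero]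
    have hbound : Real.exp (-(3 / 2 * η * t)) * (-(c / 6)) ≤ V t - c / 6 := by
      calc
        _ ≤ Real.exp (-(3 / 2 * η * t)) * (Real.exp (3 / 2 * η * t) * (V t - c / 6)) :=
          mul_le_mul_of_nonneg_left (by linarith) (Real.exp_pos _).le
        _ = V t - c / 6 := by rw [← mul_assoc, hmul, one_mul]
    have hexp : Real.exp (-(3 / 2 * η * t)) ≤ Real.exp (-(3 * η * t / 4)) :=
      Real.exp_le_exp.2 (by linarith [mul_nonneg hη.le ht.1])
    have hcexp := mul_le_mul_of_nonneg_left hexp (by positivity : 0 ≤ c / 6)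
    linarith
  refine ⟨hlower, hnonneg, fun hη2 t ht => ?_⟩
  have hηt : 2 ≤ η * t := by nlinarith [ht.1]
  have hexp : Real.exp (-(3 * η * t / 4)) ≤ 2 / 3 := by
    rw [Real.exp_neg]
    refine inv_le_of_inv_le₀ (by norm_num) ?_
    linarith [Real.add_one_le_exp (3 * η * t / 4)]
  have hcexp := mul_le_mul_of_nonneg_left hexp (by positivity : 0 ≤ c / 6)
  linarith [hlower t ⟨zero_le_one.trans ht.1, ht.2⟩]
end
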